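/- arXiv:2602.22443 — 3 statements merged into one kernel-verified Lean document; each statement's English description precedes it below -/
import Mathlib

section
/- Let k > 0 and let q ∈ (0, 1) satisfy k·q ≥ 3/2. Then log q + 1 − ψ(k q) − k q · ψ₁(k q) + ψ(k) < 0, where ψ₁(x) = Σ_{m=0}^{∞} 1/(x+m)² is the trigamma function. -/
/-- The digamma function `ψ(x) = (log Γ)'(x)`. -/
noncomputable def digamma (x : ℝ) : ℝ := deriv (fun y => Real.log (Real.Gamma y)) x

/-- The trigamma function `ψ₁(x) = ∑_{m=0}^∞ 1/(x+m)²`. -/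
noncomputable def trigamma (x : ℝ) : ℝ := ∑' m : ℕ, 1/(x + m)^2

open Filter Topology

lemma hasDerivAt_log_Gamma {x : ℝ} (hx : 0 < x) :
    HasDerivAt (Real.log ∘ Real.Gamma) (digamma x) x := by
  have h : DifferentiableAt ℝ Real.Gamma x :=
    Real.differentiableAt_Gamma fun m => by
      have : (0 : ℝ) ≤ m := m.cast_nonneg
      linarith
  exact (h.log (Real.Gamma_pos_of_pos hx).ne').hasDerivAt

lemma log_Gamma_add_one {x : ℝ} (hx : 0 < x) :
    Real.log (Real.Gamma (x + 1)) = Real.log x + Real.log (Real.Gamma x) := by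
  rw [Real.Gamma_add_one hx.ne', Real.log_mul hx.ne' (Real.Gamma_pos_of_pos hx).ne']

lemma digamma_add_one {x : ℝ} (hx : 0 < x) : digamma (x + 1) = digamma x + 1 / x := by
  have h₁ : HasDerivAt (fun y => Real.log (Real.Gamma (y + 1))) (digamma (x + 1)) x :=
    (hasDerivAt_log_Gamma (by linarith : 0 < x + 1)).comp_add_const x 1
  have h₂ : HasDerivAt (fun y => Real.log y + Real.log (Real.Gamma y)) (x⁻¹ + digamma x) x :=
    (Real.hasDerivAt_log hx.ne').add (hasDerivAt_log_Gamma hx)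
  have h₃ : (fun y => Real.log (Real.Gamma (y + 1))) =ᶠ[𝓝 x]
      fun y => Real.log y + Real.log (Real.Gamma y) := by
    filter_upwards [lt_mem_nhds hx] with y hy using log_Gamma_add_one hy
  rw [h₁.unique (h₂.congr_of_eventuallyEq h₃), one_div, add_comm]

lemma digamma_le_log {x : ℝ} (hx : 0 < x) : digamma x ≤ Real.log x := by
  have h := Real.convexOn_log_Gamma.le_slope_of_hasDerivAt (Set.mem_Ioi.2 hx)
    (Set.mem_Ioi.2 (by linarith : 0 < x + 1)) (by linarith) (hasDerivAt_log_Gamma hx)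
  simpa [slope_def_field, log_Gamma_add_one hx] using h

lemma log_le_digamma_add_one {x : ℝ} (hx : 0 < x) : Real.log x ≤ digamma (x + 1) := by
  have hx' : 0 < x + 1 := by linarith
  have h := Real.convexOn_log_Gamma.slope_le_of_hasDerivAt (Set.mem_Ioi.2 hx)
    (Set.mem_Ioi.2 hx') (by linarith) (hasDerivAt_log_Gamma hx')
  simpa [slope_def_field, log_Gamma_add_one hx] using h

lemma tendsto_log_sub_digamma :
    Tendsto (fun x => Real.log x - digamma x) atTop (𝓝 0) := by
  refine squeeze_zero' (g := fun x : ℝ => 1 / x) ?_ ?_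
    (tendsto_const_nhds.div_atTop tendsto_id)
  · filter_upwards [eventually_gt_atTop 0] with x hx using sub_nonneg.2 (digamma_le_log hx)
  · filter_upwards [eventually_gt_atTop 0] with x hx
    have h₁ := log_le_digamma_add_one hx
    rw [digamma_add_one hx] at h₁
    linarith

lemma le_log_one_add_inv {x : ℝ} (hx : 0 < x) :
    2 / (2 * x + 1) + 2 / (3 * (2 * x + 1) ^ 3) ≤ Real.log (1 + x⁻¹) := by
  have h := sum_le_hasSum (Finset.range 2) (fun k _ => by positivity)
    (Real.hasSum_log_one_add_inv hx)
  refine le_trans (le_of_eq ?_) h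
  simp [Finset.sum_range_succ]
  field_simp
  norm_num
  ring

lemma log_sub_digamma_le {x : ℝ} (hx : 0 < x) :
    Real.log x - digamma x ≤ 1 / (2 * x) + 1 / (12 * x ^ 2) := by
  set e : ℝ → ℝ := fun y => 1 / (2 * y) + 1 / (12 * y ^ 2) - (Real.log y - digamma y) with he
  have hstep (y : ℝ) (hy : 0 < y) : e (y + 1) ≤ e y := by
    have h := le_log_one_add_inv hy
    have hlog : Real.log (1 + y⁻¹) = Real.log (y + 1) - Real.log y := by
      rw [← Real.log_div (by positivity) hy.ne']
      congr 1
      field_simp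
    have hrat : 1 / y + (1 / (2 * (y + 1)) + 1 / (12 * (y + 1) ^ 2))
        - (1 / (2 * y) + 1 / (12 * y ^ 2)) ≤ 2 / (2 * y + 1) + 2 / (3 * (2 * y + 1) ^ 3) := by
      rw [← sub_nonneg]
      have : 2 / (2 * y + 1) + 2 / (3 * (2 * y + 1) ^ 3)
          - (1 / y + (1 / (2 * (y + 1)) + 1 / (12 * (y + 1) ^ 2))
            - (1 / (2 * y) + 1 / (12 * y ^ 2)))
          = ((2 * y + 1) ^ 2 + 1) / (24 * (2 * y + 1) ^ 3 * y ^ 2 * (y + 1) ^ 2) := by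
        field_simp
        ring
      rw [this]
      positivity
    simp only [he, digamma_add_one hy]
    linarith
  have hanti : Antitone fun n : ℕ => e (x + n) := antitone_nat_of_succ_le fun n => by
    simpa [add_assoc] using hstep (x + n) (by positivity)
  have hlim : Tendsto e atTop (𝓝 0) := by
    have h₁ : Tendsto (fun y : ℝ => 1 / (2 * y)) atTop (𝓝 0) :=
      tendsto_const_nhds.div_atTop (tendsto_id.const_mul_atTop two_pos)
    have h₂ : Tendsto (fun y : ℝ => 1 / (12 * y ^ 2)) atTop (𝓝 0) :=
      tendsto_const_nhds.div_atTop
        ((tendsto_pow_atTop two_ne_zero).const_mul_atTop (by norm_num))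
    simpa only [add_zero, sub_zero] using (h₁.add h₂).sub tendsto_log_sub_digamma
  have h := hanti.le_of_tendsto
    (hlim.comp (tendsto_atTop_add_const_left _ x tendsto_natCast_atTop_atTop)) 0
  simp only [he, Nat.cast_zero, add_zero] at h
  linarith

lemma summable_one_div_add_nat_sq {x : ℝ} (hx : 0 < x) :
    Summable fun m : ℕ => 1 / (x + m) ^ 2 := by
  refine ((Real.summable_one_div_nat_add_rpow x 2).2 one_lt_two).congr fun m => ?_
  rw [abs_of_pos (by positivity), add_comm x]
  norm_cast

lemma le_trigamma {x : ℝ} (hx : 1 ≤ x) :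
    1 / x + 1 / (2 * x ^ 2) + 1 / (8 * x ^ 3) ≤ trigamma x := by
  have hx₀ : 0 < x := by linarith
  set p : ℝ → ℝ := fun y => 1 / y + 1 / (2 * y ^ 2) + 1 / (8 * y ^ 3) with hp
  have hstep (y : ℝ) (hy : 1 ≤ y) : p y ≤ 1 / y ^ 2 + p (y + 1) := by
    have hy₀ : 0 < y := by linarith
    rw [← sub_nonneg]
    have : 1 / y ^ 2 + p (y + 1) - p y
        = (y ^ 2 + y - 1) / (8 * y ^ 3 * (y + 1) ^ 3) := by
      simp only [hp]
      field_simp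
      ring
    rw [this]
    have : 0 ≤ y ^ 2 + y - 1 := by nlinarith
    positivity
  have hmono : Monotone fun n : ℕ => ∑ m ∈ Finset.range n, 1 / (x + m) ^ 2 + p (x + n) :=
    monotone_nat_of_le_succ fun n => by
      have h := hstep (x + n) (by linarith [n.cast_nonneg (α := ℝ)])
      rw [Finset.sum_range_succ, Nat.cast_succ, ← add_assoc x]
      linarith
  have hlim : Tendsto p atTop (𝓝 0) := by
    have h₁ : Tendsto (fun y : ℝ => 1 / y) atTop (𝓝 0) :=
      tendsto_const_nhds.div_atTop tendsto_id
    have h₂ : Tendsto (fun y : ℝ => 1 / (2 * y ^ 2)) atTop (𝓝 0) :=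
      tendsto_const_nhds.div_atTop
        ((tendsto_pow_atTop two_ne_zero).const_mul_atTop (by norm_num))
    have h₃ : Tendsto (fun y : ℝ => 1 / (8 * y ^ 3)) atTop (𝓝 0) :=
      tendsto_const_nhds.div_atTop
        ((tendsto_pow_atTop three_ne_zero).const_mul_atTop (by norm_num))
    simpa only [add_zero] using (h₁.add h₂).add h₃
  have h := hmono.ge_of_tendsto ((summable_one_div_add_nat_sq hx₀).hasSum.tendsto_sum_nat.add
    (hlim.comp (tendsto_atTop_add_const_left _ x tendsto_natCast_atTop_atTop))) 0
  simpa [hp, trigamma] using h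

theorem stmt_8 (k q : ℝ) (hk : 0 < k) (hq : q ∈ Set.Ioo (0:ℝ) 1)
    (hkq : 3/2 ≤ k * q) :
    Real.log q + 1 - digamma (k*q) - k*q * trigamma (k*q) + digamma k < 0 := by
  have hlog : Real.log (k * q) = Real.log k + Real.log q := Real.log_mul hk.ne' hq.1.ne'
  generalize k * q = x at *
  have hx : 0 < x := by linarith
  have h₁ := log_sub_digamma_le hx
  have h₂ := mul_le_mul_of_nonneg_left (le_trigamma (by linarith : 1 ≤ x)) hx.le
  have h₃ := digamma_le_log hk
  have h₄ : x * (1 / x + 1 / (2 * x ^ 2) + 1 / (8 * x ^ 3))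
      = 1 + 1 / (2 * x) + 1 / (12 * x ^ 2) + 1 / (24 * x ^ 2) := by
    field_simp
    ring
  have h₅ : 0 < 1 / (24 * x ^ 2) := by positivity
  linarith
end

section
/- Let n and N be integers with 2 ≤ n ≤ N, let k > 0, and let p ∈ [1/N, 1 − (n−1)/N]. Then p^{k p} (1−p)^{k(1−p)} / B(k p, k(1−p)) ≥ (1/N)^{k(1 − (n−1)/N)} · ((n−1)/N)^{k(1 − 1/N)} / B(k/N, k(n−1)/N). -/
/-- The Beta function `B(a,b) = Γ(a)Γ(b)/Γ(a+b)`. -/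
noncomputable def betaFn (a b : ℝ) : ℝ := Real.Gamma a * Real.Gamma b / Real.Gamma (a + b)

theorem Gamma_add_mul_Gamma_add_le {x s t : ℝ} (hx : 0 < x) (hs : 0 ≤ s) (ht : 0 < t) :
    Real.Gamma (x + s) * Real.Gamma (x + t) ≤ Real.Gamma x * Real.Gamma (x + s + t) := by
  have hst : 0 < s + t := by linarith
  have hy : 0 < x + s + t := by linarith
  have hw : s / (s + t) + t / (s + t) = 1 := by field_simp
  have hw' : t / (s + t) + s / (s + t) = 1 := by field_simp; ring
  have hs' : 0 ≤ s / (s + t) := by positivity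
  have ht' : 0 ≤ t / (s + t) := by positivity
  have h₁ := Real.convexOn_log_Gamma.2 (Set.mem_Ioi.2 hx) (Set.mem_Ioi.2 hy) hs' ht' hw
  have h₂ := Real.convexOn_log_Gamma.2 (Set.mem_Ioi.2 hx) (Set.mem_Ioi.2 hy) ht' hs' hw'
  have e₁ : s / (s + t) * x + t / (s + t) * (x + s + t) = x + t := by field_simp; ring
  have e₂ : t / (s + t) * x + s / (s + t) * (x + s + t) = x + s := by field_simp; ring
  simp only [smul_eq_mul, Function.comp_apply, e₁, e₂] at h₁ h₂
  have gx := Real.Gamma_pos_of_pos hx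
  have gy := Real.Gamma_pos_of_pos hy
  have gs := Real.Gamma_pos_of_pos (show 0 < x + s by linarith)
  have gt := Real.Gamma_pos_of_pos (show 0 < x + t by linarith)
  rw [← Real.log_le_log_iff (by positivity) (by positivity), Real.log_mul gs.ne' gt.ne',
    Real.log_mul gx.ne' gy.ne']
  calc Real.log (Real.Gamma (x + s)) + Real.log (Real.Gamma (x + t))
      ≤ (s / (s + t) + t / (s + t)) *
          (Real.log (Real.Gamma x) + Real.log (Real.Gamma (x + s + t))) := by linarith
    _ = _ := by rw [hw, one_mul]

theorem betaFn_pos {a b : ℝ} (ha : 0 < a) (hb : 0 < b) : 0 < betaFn a b :=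
  div_pos (mul_pos (Real.Gamma_pos_of_pos ha) (Real.Gamma_pos_of_pos hb))
    (Real.Gamma_pos_of_pos (add_pos ha hb))

theorem betaFn_comm (a b : ℝ) : betaFn a b = betaFn b a := by
  rw [betaFn, betaFn, mul_comm, add_comm]

theorem betaFn_le_betaFn_left {a a' b : ℝ} (ha : 0 < a) (h : a ≤ a') (hb : 0 < b) :
    betaFn a' b ≤ betaFn a b := by
  have key := Gamma_add_mul_Gamma_add_le ha (sub_nonneg.2 h) hb
  rw [add_sub_cancel] at key
  rw [betaFn, betaFn, div_le_div_iff₀ (Real.Gamma_pos_of_pos (by linarith))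
    (Real.Gamma_pos_of_pos (by linarith))]
  have := mul_le_mul_of_nonneg_right key (Real.Gamma_pos_of_pos hb).le
  linarith

theorem betaFn_le_betaFn {a a' b b' : ℝ} (ha : 0 < a) (haa' : a ≤ a') (hb : 0 < b)
    (hbb' : b ≤ b') : betaFn a' b' ≤ betaFn a b :=
  calc betaFn a' b' ≤ betaFn a b' := betaFn_le_betaFn_left ha haa' (hb.trans_le hbb')
    _ = betaFn b' a := betaFn_comm _ _
    _ ≤ betaFn b a := betaFn_le_betaFn_left hb hbb' ha
    _ = betaFn a b := betaFn_comm _ _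

theorem rpow_le_rpow_of_base_le_of_exponent_ge {x y u v : ℝ} (hx : 0 < x) (hxy : x ≤ y)
    (hy : y ≤ 1) (hu : 0 ≤ u) (hvu : v ≤ u) : x ^ u ≤ y ^ v :=
  (Real.rpow_le_rpow hx.le hxy hu).trans
    (Real.rpow_le_rpow_of_exponent_ge (hx.trans_le hxy) hy hvu)

theorem stmt_13 (n N : ℕ) (hn : 2 ≤ n) (hnN : n ≤ N) (k : ℝ) (hk : 0 < k)
    (p : ℝ) (hp : p ∈ Set.Icc (1/(N:ℝ)) (1 - ((n:ℝ)-1)/N)) :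
    (1/(N:ℝ)) ^ (k*(1 - ((n:ℝ)-1)/N)) * (((n:ℝ)-1)/N) ^ (k*(1 - 1/(N:ℝ))) /
        betaFn (k/(N:ℝ)) (k*((n:ℝ)-1)/N) ≤
      p ^ (k*p) * (1-p) ^ (k*(1-p)) / betaFn (k*p) (k*(1-p)) := by
  obtain ⟨hp₁, hp₂⟩ := hp
  have hn' : (2 : ℝ) ≤ n := by exact_mod_cast hn
  have hN' : (0 : ℝ) < N := by exact_mod_cast (by omega : 0 < N)
  rw [mul_div_assoc k, ← mul_one_div k (N : ℝ)]
  have ha : 0 < 1 / (N : ℝ) := by positivity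
  have hb : 0 < ((n : ℝ) - 1) / N := div_pos (by linarith) hN'
  generalize 1 / (N : ℝ) = a at *
  generalize ((n : ℝ) - 1) / N = b at *
  have hp₀ : 0 < p := by linarith
  have hq₀ : 0 < 1 - p := by linarith
  have h₁ : a ^ (k * (1 - b)) ≤ p ^ (k * p) :=
    rpow_le_rpow_of_base_le_of_exponent_ge ha hp₁ (by linarith)
      (mul_nonneg hk.le (by linarith)) (mul_le_mul_of_nonneg_left hp₂ hk.le)
  have h₂ : b ^ (k * (1 - a)) ≤ (1 - p) ^ (k * (1 - p)) :=
    rpow_le_rpow_of_base_le_of_exponent_ge hb (by linarith) (by linarith)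
      (mul_nonneg hk.le (by linarith)) (mul_le_mul_of_nonneg_left (by linarith) hk.le)
  have h₃ : betaFn (k * p) (k * (1 - p)) ≤ betaFn (k * a) (k * b) :=
    betaFn_le_betaFn (mul_pos hk ha) (mul_le_mul_of_nonneg_left hp₁ hk.le) (mul_pos hk hb)
      (mul_le_mul_of_nonneg_left (by linarith) hk.le)
  exact div_le_div₀ (by positivity) (mul_le_mul h₁ h₂ (by positivity) (by positivity))
    (betaFn_pos (mul_pos hk hp₀) (mul_pos hk hq₀)) h₃
end

section
/- Let n ≥ 3 be an integer and for each row index i ∈ {1, …, n} let N_i be a positive integer, η_i ∈ (0, 1/4) with η_i + 1/N_i ≤ 1 − 2η_i, γ_i ∈ (0, 1/(n−1)], and k_i ≥ 3/(2η_i). For each i, let p⁽ⁱ⁾, q⁽ⁱ⁾ ∈ ℝⁿ be vectors with entries in [η_i, 1 − 2η_i] summing to 1, and suppose there is a single index j such that p⁽ⁱ⁾ = q⁽ⁱ⁾ for all i ≠ j, while p⁽ʲ⁾ and q⁽ʲ⁾ differ in exactly two coordinates a ≠ b with p⁽ʲ⁾_a = q⁽ʲ⁾_a + 1/N_j, p⁽ʲ⁾_b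 = q⁽ʲ⁾_b − 1/N_j. Let P = μ_{k_1 p⁽¹⁾} ⊗ ⋯ ⊗ μ_{k_n p⁽ⁿ⁾} and Q = μ_{k_1 q⁽¹⁾} ⊗ ⋯ ⊗ μ_{k_n q⁽ⁿ⁾} be the product Dirichlet measures, let Ω₁⁽ʲ⁾ = { x ∈ ℝ^{n−1} : x_l ≥ γ_j for all l, 1 − Σ_l x_l ≥ γ_j }, and let δ ≥ 1 − μ_{k_j p⁽ʲ⁾}(Ω₁⁽ʲ⁾). Then for every measurable set T, P(T) ≤ e^{ε_j} Q(T) + δ, where ε_j = log( B(k_j η_j, k_j(1−2η_j)) / B(k_j(η_j + 1/N_j), k_j(1−2η_j−1/N_j)) ) + (k_j/N_j)·log((1−(n−1)γ_j)/γ_j). -/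
open MeasureTheory ENNReal

/-- The multivariate Beta function `B(y) = (∏ i, Γ(y i)) / Γ(∑ i, y i)`. -/
noncomputable def multiBeta {n : ℕ} (y : Fin n → ℝ) : ℝ :=
  (∏ i, Real.Gamma (y i)) / Real.Gamma (∑ i, y i)

/-- The Dirichlet measure on `ℝ^m` with parameter vector `α : Fin (m+1) → ℝ`:
the measure with density `B(α)⁻¹ ∏ x_i^{α_i - 1} (1 - ∑ x_i)^{α_{m+1} - 1}` on the
open simplex and zero elsewhere. -/
noncomputable def dirichletMeasure {m : ℕ} (α : Fin (m+1) → ℝ) :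
    Measure (Fin m → ℝ) :=
  volume.withDensity fun x =>
    ENNReal.ofReal <|
      if (∀ i, 0 < x i) ∧ ∑ i, x i < 1 then
        (multiBeta α)⁻¹ * (∏ i : Fin m, x i ^ (α i.castSucc - 1)) *
          (1 - ∑ i, x i) ^ (α (Fin.last m) - 1)
      else 0

/-- The unnormalized Dirichlet density on the open simplex of size `s`. -/
noncomputable def dirichletKernel {m : ℕ} (α : Fin (m+1) → ℝ) (s : ℝ) (x : Fin m → ℝ) : ℝ :=
  if (∀ i, 0 < x i) ∧ ∑ i, x i < s then
    (∏ i : Fin m, x i ^ (α i.castSucc - 1)) * (s - ∑ i, x i) ^ (α (Fin.last m) - 1)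
  else 0

theorem measurable_dirichletKernel {m : ℕ} (α : Fin (m+1) → ℝ) (s : ℝ) :
    Measurable (dirichletKernel α s) := by
  unfold dirichletKernel
  refine Measurable.ite ?_ (by fun_prop) measurable_const
  refine MeasurableSet.inter (s₁ := {x : Fin m → ℝ | ∀ i, 0 < x i})
    (s₂ := {x : Fin m → ℝ | ∑ i, x i < s}) ?_ ?_
  · rw [Set.ofPred_forall]
    exact MeasurableSet.iInter fun i => measurableSet_lt measurable_const (measurable_pi_apply i)
  · exact measurableSet_lt (by fun_prop) measurable_const

theorem dirichletKernel_nonneg {m : ℕ} (α : Fin (m+1) → ℝ) (s : ℝ) (x : Fin m → ℝ) :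
    0 ≤ dirichletKernel α s x := by
  unfold dirichletKernel
  split_ifs with h
  · exact mul_nonneg (Finset.prod_nonneg fun i _ => Real.rpow_nonneg (h.1 i).le _)
      (Real.rpow_nonneg (by linarith [h.2]) _)
  · exact le_rfl

theorem dirichletKernel_cons {m : ℕ} (α : Fin (m+2) → ℝ) (s t : ℝ) (y : Fin m → ℝ) :
    dirichletKernel α s (Fin.cons t y) =
      (if 0 < t ∧ t < s then t ^ (α 0 - 1) else 0) *
        dirichletKernel (fun i => α i.succ) (s - t) y := by
  unfold dirichletKernel
  simp only [Fin.forall_fin_succ, Fin.cons_zero, Fin.cons_succ, Fin.sum_univ_succ,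
    Fin.prod_univ_succ]
  by_cases hy : ∀ i, 0 < y i
  · have hsum : 0 ≤ ∑ i, y i := Finset.sum_nonneg fun i _ => (hy i).le
    by_cases ht : 0 < t
    · by_cases hlt : t + ∑ i, y i < s
      · rw [if_pos ⟨⟨ht, hy⟩, hlt⟩, if_pos ⟨ht, by linarith⟩, if_pos ⟨hy, by linarith⟩]
        simp only [Fin.castSucc_zero, Fin.succ_castSucc, Fin.succ_last, sub_sub, mul_assoc]
      · rw [if_neg (fun h => hlt h.2), if_neg (c := _ ∧ ∑ i, y i < s - t)
          (fun h => hlt (by linarith [h.2])), mul_zero]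
    · simp [ht]
  · simp [hy]

/-- The Beta integral over `(0, s)`. -/
theorem lintegral_beta_scaled {a b s : ℝ} (ha : 0 < a) (hb : 0 < b) (hs : 0 < s) :
    ∫⁻ t, ENNReal.ofReal ((if 0 < t ∧ t < s then t ^ (a - 1) else 0) * (s - t) ^ (b - 1)) =
      ENNReal.ofReal (ProbabilityTheory.beta a b * s ^ (a + b - 1)) := by
  have hB := ProbabilityTheory.beta_pos ha hb
  rw [← Real.smul_map_volume_mul_left hs.ne', lintegral_smul_measure,
    lintegral_map' (Measurable.aemeasurable ?_) (by fun_prop)]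
  · have key : ∀ t : ℝ, ENNReal.ofReal
        ((if 0 < s * t ∧ s * t < s then (s * t) ^ (a - 1) else 0) * (s - s * t) ^ (b - 1)) =
        ENNReal.ofReal (ProbabilityTheory.beta a b * s ^ (a + b - 2)) *
          ProbabilityTheory.betaPDF a b t := by
      intro t
      rw [ProbabilityTheory.betaPDF_eq, ← ENNReal.ofReal_mul (by positivity)]
      have h1 : (0 < s * t ∧ s * t < s) ↔ (0 < t ∧ t < 1) := by
        rw [mul_pos_iff_of_pos_left hs, mul_lt_iff_lt_one_right hs]
      congr 1
      by_cases h : 0 < t ∧ t < 1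
      · rw [if_pos (h1.2 h), if_pos h, Real.mul_rpow hs.le h.1.le,
          show s - s * t = s * (1 - t) by ring, Real.mul_rpow hs.le (by linarith [h.2]),
          show a + b - 2 = (a - 1) + (b - 1) by ring, Real.rpow_add hs]
        field_simp
      · rw [if_neg (mt h1.1 h), if_neg h]
        simp
    simp_rw [key]
    rw [lintegral_const_mul' _ _ ENNReal.ofReal_ne_top,
      ProbabilityTheory.lintegral_betaPDF_eq_one ha hb, mul_one, smul_eq_mul,
      ← ENNReal.ofReal_mul (abs_nonneg _), abs_of_pos hs]
    congr 1
    rw [show a + b - 1 = (a + b - 2) + 1 by ring, Real.rpow_add_one hs.ne']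
    ring
  · exact ((Measurable.ite measurableSet_Ioo (by fun_prop) measurable_const).mul
      (by fun_prop)).ennreal_ofReal

theorem multiBeta_pos {m : ℕ} {α : Fin (m+1) → ℝ} (hα : ∀ i, 0 < α i) : 0 < multiBeta α :=
  div_pos (Finset.prod_pos fun i _ => Real.Gamma_pos_of_pos (hα i))
    (Real.Gamma_pos_of_pos (Finset.sum_pos (fun i _ => hα i) Finset.univ_nonempty))

theorem multiBeta_succ {m : ℕ} {α : Fin (m+2) → ℝ} (hα : ∀ i, 0 < α i) :
    multiBeta α =
      multiBeta (fun i => α i.succ) * ProbabilityTheory.beta (α 0) (∑ i : Fin (m+1), α i.succ) := by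
  have : Real.Gamma (∑ i : Fin (m+1), α i.succ) ≠ 0 :=
    (Real.Gamma_pos_of_pos (Finset.sum_pos (fun i _ => hα i.succ) Finset.univ_nonempty)).ne'
  rw [multiBeta, multiBeta, ProbabilityTheory.beta, Fin.sum_univ_succ, Fin.prod_univ_succ]
  field_simp

/-- The Dirichlet integral over the simplex of size `s`. -/
theorem lintegral_dirichletKernel {m : ℕ} {α : Fin (m+1) → ℝ} (hα : ∀ i, 0 < α i) {s : ℝ}
    (hs : 0 < s) :
    ∫⁻ x, ENNReal.ofReal (dirichletKernel α s x) =
      ENNReal.ofReal (multiBeta α * s ^ (∑ i, α i - 1)) := by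
  induction m generalizing s with
  | zero =>
    have h := (Real.Gamma_pos_of_pos (hα 0)).ne'
    simp [lintegral_unique, dirichletKernel, hs, multiBeta, div_self h, volume_pi]
  | succ m ih =>
    have hσ : 0 < ∑ i : Fin (m+1), α i.succ :=
      Finset.sum_pos (fun i _ => hα i.succ) Finset.univ_nonempty
    have hM := multiBeta_pos (α := fun i : Fin (m+1) => α i.succ) fun i => hα i.succ
    have hmp := (volume_preserving_piFinSuccAbove (fun _ : Fin (m+1) => ℝ) 0).symm
    rw [hmp.lintegral_map_equiv, Measure.volume_eq_prod, lintegral_prod]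
    · have key : ∀ t : ℝ, ∫⁻ y, ENNReal.ofReal (dirichletKernel α s
          ((MeasurableEquiv.piFinSuccAbove (fun _ : Fin (m+1) => ℝ) 0).symm (t, y))) =
          ENNReal.ofReal (multiBeta fun i : Fin (m+1) => α i.succ) *
          ENNReal.ofReal ((if 0 < t ∧ t < s then t ^ (α 0 - 1) else 0) *
            (s - t) ^ (∑ i : Fin (m+1), α i.succ - 1)) := by
        intro t
        have hc : ∀ y : Fin m → ℝ,
            (MeasurableEquiv.piFinSuccAbove (fun _ : Fin (m+1) => ℝ) 0).symm (t, y) =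
              Fin.cons t y := fun y => Fin.insertNth_zero' t y
        simp_rw [hc, dirichletKernel_cons]
        by_cases ht : 0 < t ∧ t < s
        · simp_rw [if_pos ht]
          have hp := Real.rpow_nonneg ht.1.le (α 0 - 1)
          simp_rw [ENNReal.ofReal_mul hp]
          rw [lintegral_const_mul' _ _ ENNReal.ofReal_ne_top,
            ih (fun i => hα i.succ) (sub_pos.2 ht.2), ENNReal.ofReal_mul hM.le]
          ring
        · simp [if_neg ht]
      simp_rw [key]
      rw [lintegral_const_mul' _ _ ENNReal.ofReal_ne_top, lintegral_beta_scaled (hα 0) hσ hs,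
        ← ENNReal.ofReal_mul hM.le, multiBeta_succ hα, Fin.sum_univ_succ α, mul_assoc]
    · exact ((measurable_dirichletKernel α s).comp
        (MeasurableEquiv.measurable _)).ennreal_ofReal.aemeasurable

theorem dirichletMeasure_eq {m : ℕ} (α : Fin (m+1) → ℝ) :
    dirichletMeasure α =
      volume.withDensity fun x => ENNReal.ofReal ((multiBeta α)⁻¹ * dirichletKernel α 1 x) := by
  simp only [dirichletMeasure, dirichletKernel, mul_ite, mul_zero, mul_assoc]

theorem isProbabilityMeasure_dirichletMeasure {m : ℕ} {α : Fin (m+1) → ℝ} (hα : ∀ i, 0 < α i) :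
    IsProbabilityMeasure (dirichletMeasure α) := by
  have hM := multiBeta_pos hα
  constructor
  rw [dirichletMeasure_eq, withDensity_apply _ MeasurableSet.univ, Measure.restrict_univ]
  simp_rw [ENNReal.ofReal_mul (inv_nonneg.2 hM.le)]
  rw [lintegral_const_mul' _ _ ENNReal.ofReal_ne_top, lintegral_dirichletKernel hα one_pos,
    ← ENNReal.ofReal_mul (inv_nonneg.2 hM.le), Real.one_rpow, mul_one, inv_mul_cancel₀ hM.ne',
    ENNReal.ofReal_one]

/-- A privacy bound for one factor of a product of probability measures carries over to the
product. -/
theorem pi_le_mul_pi_add {m : ℕ} {X : Type*} [MeasurableSpace X] (μ ν : Fin (m+1) → Measure X)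
    [∀ i, IsProbabilityMeasure (μ i)] [∀ i, IsProbabilityMeasure (ν i)] (j : Fin (m+1))
    (h : ∀ i, i ≠ j → μ i = ν i) {Ω : Set X} (hΩ : MeasurableSet Ω) {C : ℝ≥0∞}
    (hle : (μ j).restrict Ω ≤ C • ν j) {T : Set (Fin (m+1) → X)} (hT : MeasurableSet T) :
    Measure.pi μ T ≤ C * Measure.pi ν T + μ j Ωᶜ := by
  have hμ := (measurePreserving_piFinSuccAbove μ j).symm
  have hν := (measurePreserving_piFinSuccAbove ν j).symm
  have hrest : (fun i => μ (j.succAbove i)) = fun i => ν (j.succAbove i) :=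
    funext fun i => h _ (j.succAbove_ne i)
  have hS := (MeasurableEquiv.measurable
    (MeasurableEquiv.piFinSuccAbove (fun _ : Fin (m+1) => X) j).symm) hT
  rw [← hμ.measure_preimage hT.nullMeasurableSet, ← hν.measure_preimage hT.nullMeasurableSet,
    hrest, Measure.prod_apply hS, Measure.prod_apply hS, ← lintegral_add_compl _ hΩ]
  refine add_le_add ?_ ?_
  · refine (lintegral_mono' hle le_rfl).trans ?_
    rw [lintegral_smul_measure, smul_eq_mul]
  · refine (lintegral_mono (g := fun _ => 1) fun x => prob_le_one).trans ?_
    simp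

theorem Gamma_div_Gamma_add_le {x y h : ℝ} (hx : 0 < x) (hxy : x ≤ y) (hh : 0 ≤ h) :
    Real.Gamma y / Real.Gamma (y + h) ≤ Real.Gamma x / Real.Gamma (x + h) := by
  have hy : 0 < y := hx.trans_le hxy
  have g1 := Real.Gamma_pos_of_pos hx
  have g2 := Real.Gamma_pos_of_pos hy
  have g3 := Real.Gamma_pos_of_pos (add_pos_of_pos_of_nonneg hx hh)
  have g4 := Real.Gamma_pos_of_pos (add_pos_of_pos_of_nonneg hy hh)
  rw [← Real.log_le_log_iff (by positivity) (by positivity), Real.log_div g2.ne' g4.ne',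
    Real.log_div g1.ne' g3.ne']
  rcases hh.eq_or_lt with rfl | hh
  · simp
  rcases hxy.eq_or_lt with rfl | hxy
  · rfl
  have hc := Real.convexOn_log_Gamma
  have m1 : x ∈ Set.Ioi (0:ℝ) := hx
  have m2 : y + h ∈ Set.Ioi (0:ℝ) := Set.mem_Ioi.2 (by linarith)
  have e1 := hc.secant_mono_aux1 m1 m2 (y := y) hxy (by linarith)
  have e2 := hc.secant_mono_aux1 m1 m2 (y := x + h) (by linarith) (by linarith)
  simp only [Function.comp] at e1 e2
  have : 0 < y + h - x := by linarith
  nlinarith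

/-- Coordinates of a point of the simplex, the last one being recovered from the others. -/
def simplexCoord {m : ℕ} (x : Fin m → ℝ) : Fin (m+1) → ℝ :=
  Fin.snoc (α := fun _ => ℝ) x (1 - ∑ i, x i)

theorem sum_simplexCoord {m : ℕ} (x : Fin m → ℝ) : ∑ l, simplexCoord x l = 1 := by
  simp [simplexCoord, Fin.sum_univ_castSucc]

theorem dirichletKernel_eq_prod {m : ℕ} (α : Fin (m+1) → ℝ) {x : Fin m → ℝ}
    (hx : ∀ l, 0 < simplexCoord x l) :
    dirichletKernel α 1 x = ∏ l, simplexCoord x l ^ (α l - 1) := by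
  rw [Fin.forall_fin_succ'] at hx
  simp only [simplexCoord, Fin.snoc_castSucc, Fin.snoc_last] at hx
  rw [dirichletKernel, if_pos ⟨hx.1, by linarith [hx.2]⟩]
  simp [simplexCoord, Fin.prod_univ_castSucc]

theorem prod_mul_eq_of_eq_off_pair {ι : Type*} [Fintype ι] [DecidableEq ι] {f g : ι → ℝ} {a b : ι}
    (hab : a ≠ b) (h : ∀ l, l ≠ a → l ≠ b → f l = g l) :
    (∏ l, f l) * (g a * g b) = (∏ l, g l) * (f a * f b) := by
  have hb : b ∈ Finset.univ.erase a := by simp [hab.symm]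
  rw [← Finset.mul_prod_erase _ f (Finset.mem_univ a), ← Finset.mul_prod_erase _ f hb,
    ← Finset.mul_prod_erase _ g (Finset.mem_univ a), ← Finset.mul_prod_erase _ g hb,
    Finset.prod_congr rfl fun l hl => h l (by aesop) (by aesop)]
  ring

/-- The set of points whose simplex coordinates are all at least `c`. -/
def truncatedSimplex (m : ℕ) (c : ℝ) : Set (Fin m → ℝ) :=
  {x : Fin m → ℝ | (∀ l, c ≤ x l) ∧ c ≤ 1 - ∑ l, x l}

theorem measurableSet_truncatedSimplex (m : ℕ) (c : ℝ) :
    MeasurableSet (truncatedSimplex m c) := by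
  refine MeasurableSet.inter (s₁ := {x : Fin m → ℝ | ∀ i, c ≤ x i})
    (s₂ := {x : Fin m → ℝ | c ≤ 1 - ∑ i, x i}) ?_ ?_
  · rw [Set.ofPred_forall]
    exact MeasurableSet.iInter fun i => measurableSet_le measurable_const (measurable_pi_apply i)
  · exact measurableSet_le measurable_const (by fun_prop)

theorem le_simplexCoord {m : ℕ} {c : ℝ} {x : Fin m → ℝ} (hx : x ∈ truncatedSimplex m c)
    (l : Fin (m+1)) : c ≤ simplexCoord x l := by
  revert l
  rw [Fin.forall_fin_succ']
  simpa only [simplexCoord, Fin.snoc_castSucc, Fin.snoc_last] using! hx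

theorem simplexCoord_le {m : ℕ} {c : ℝ} {x : Fin m → ℝ} (hx : x ∈ truncatedSimplex m c)
    (l : Fin (m+1)) : simplexCoord x l ≤ 1 - m * c := by
  have h := Finset.card_nsmul_le_sum (Finset.univ.erase l) (simplexCoord x) c
    fun i _ => le_simplexCoord hx i
  rw [Finset.card_erase_of_mem (Finset.mem_univ l), Finset.card_univ, Fintype.card_fin,
    Nat.add_sub_cancel, nsmul_eq_mul] at h
  have := Finset.add_sum_erase _ (simplexCoord x) (Finset.mem_univ l)
  rw [sum_simplexCoord] at this
  linarith

section DensityRatio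

variable {m : ℕ} {α β : Fin (m+1) → ℝ} {a b : Fin (m+1)} {h lo hi : ℝ}

theorem inv_multiBeta_le (hα : ∀ l, 0 < α l) (hβ : ∀ l, 0 < β l) (hab : a ≠ b) (hh : 0 ≤ h)
    (ha : α a = β a + h) (hb : α b = β b - h) (hother : ∀ l, l ≠ a → l ≠ b → α l = β l)
    (hlo : 0 < lo) (hloa : lo ≤ β a) (hbhi : β b ≤ hi) (hsum : ∑ l, α l = ∑ l, β l) :
    (multiBeta α)⁻¹ ≤ betaFn lo hi / betaFn (lo + h) (hi - h) * (multiBeta β)⁻¹ := by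
  have hαb := hα b
  have hb' : β b = α b + h := by linarith
  have G := fun {y : ℝ} (hy : 0 < y) => Real.Gamma_pos_of_pos hy
  have gαa := G (hα a)
  have gαb := G (hα b)
  have gβa := G (hβ a)
  have gβb := G (hβ b)
  have glo := G hlo
  have gloh := G (add_pos_of_pos_of_nonneg hlo hh)
  have hhi : 0 < hi - h := by linarith
  have ghih := G hhi
  have ghi := G (show 0 < hi by linarith)
  have gs := G (show 0 < lo + hi by linarith)
  have r1 : Real.Gamma (β a) / Real.Gamma (α a) ≤ Real.Gamma lo / Real.Gamma (lo + h) :=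
    ha ▸ Gamma_div_Gamma_add_le hlo hloa hh
  have r2 : Real.Gamma (β b) / Real.Gamma (α b) ≤ Real.Gamma hi / Real.Gamma (hi - h) := by
    have := Gamma_div_Gamma_add_le hαb (show α b ≤ hi - h by linarith) hh
    rw [sub_add_cancel, ← hb', div_le_div_iff₀ ghi gβb] at this
    rw [div_le_div_iff₀ gαb ghih]
    linarith
  have hB : betaFn lo hi / betaFn (lo + h) (hi - h) =
      Real.Gamma lo / Real.Gamma (lo + h) * (Real.Gamma hi / Real.Gamma (hi - h)) := by
    rw [betaFn, betaFn, show lo + h + (hi - h) = lo + hi by ring]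
    field_simp
  have hM : (multiBeta α)⁻¹ =
      Real.Gamma (β a) / Real.Gamma (α a) * (Real.Gamma (β b) / Real.Gamma (α b)) *
        (multiBeta β)⁻¹ := by
    have hp := prod_mul_eq_of_eq_off_pair (f := fun l => Real.Gamma (α l))
      (g := fun l => Real.Gamma (β l)) hab fun l h1 h2 => by rw [hother l h1 h2]
    have pα : 0 < ∏ l, Real.Gamma (α l) := Finset.prod_pos fun l _ => G (hα l)
    have pβ : 0 < ∏ l, Real.Gamma (β l) := Finset.prod_pos fun l _ => G (hβ l)
    rw [multiBeta, multiBeta, hsum, inv_div, inv_div]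
    field_simp
    linear_combination (-Real.Gamma (∑ l, β l)) * hp
  rw [hM, hB]
  have := (multiBeta_pos hβ).le
  gcongr

theorem dirichletKernel_le {c : ℝ} (hab : a ≠ b) (hh : 0 ≤ h)
    (ha : α a = β a + h) (hb : α b = β b - h) (hother : ∀ l, l ≠ a → l ≠ b → α l = β l)
    (hc : 0 < c) {x : Fin m → ℝ} (hx : x ∈ truncatedSimplex m c) :
    dirichletKernel α 1 x ≤ ((1 - m * c) / c) ^ h * dirichletKernel β 1 x := by
  have hpos : ∀ l, 0 < simplexCoord x l := fun l => hc.trans_le (le_simplexCoord hx l)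
  have hp := prod_mul_eq_of_eq_off_pair (f := fun l => simplexCoord x l ^ (α l - 1))
    (g := fun l => simplexCoord x l ^ (β l - 1)) hab fun l h1 h2 => by rw [hother l h1 h2]
  have e1 : simplexCoord x a ^ (α a - 1) = simplexCoord x a ^ (β a - 1) * simplexCoord x a ^ h := by
    rw [← Real.rpow_add (hpos a), ha]; ring_nf
  have e2 : simplexCoord x b ^ (β b - 1) = simplexCoord x b ^ (α b - 1) * simplexCoord x b ^ h := by
    rw [← Real.rpow_add (hpos b), hb]; ring_nf
  have p1 := Real.rpow_pos_of_pos (hpos a) (β a - 1)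
  have p2 := Real.rpow_pos_of_pos (hpos b) (α b - 1)
  have p3 := Real.rpow_pos_of_pos (hpos b) h
  have heq : dirichletKernel α 1 x =
      (simplexCoord x a / simplexCoord x b) ^ h * dirichletKernel β 1 x := by
    rw [dirichletKernel_eq_prod α hpos, dirichletKernel_eq_prod β hpos,
      Real.div_rpow (hpos a).le (hpos b).le]
    simp only [e1, e2] at hp
    field_simp
    refine mul_right_cancel₀ (mul_pos p1 p2).ne' ?_
    linear_combination hp
  rw [heq]
  refine mul_le_mul_of_nonneg_right (Real.rpow_le_rpow (div_pos (hpos a) (hpos b)).le ?_ hh)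
    (dirichletKernel_nonneg _ _ _)
  exact div_le_div₀ ((hpos a).le.trans (simplexCoord_le hx a)) (simplexCoord_le hx a) hc
    (le_simplexCoord hx b)

theorem dirichletMeasure_restrict_le {c : ℝ} (hα : ∀ l, 0 < α l) (hβ : ∀ l, 0 < β l)
    (hab : a ≠ b) (hh : 0 ≤ h) (ha : α a = β a + h) (hb : α b = β b - h)
    (hother : ∀ l, l ≠ a → l ≠ b → α l = β l) (hlo : 0 < lo) (hloa : lo ≤ β a) (hbhi : β b ≤ hi)
    (hsum : ∑ l, α l = ∑ l, β l) (hc : 0 < c) :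
    (dirichletMeasure α).restrict (truncatedSimplex m c) ≤
      ENNReal.ofReal (Real.exp (Real.log (betaFn lo hi / betaFn (lo + h) (hi - h)) +
        h * Real.log ((1 - m * c) / c))) • dirichletMeasure β := by
  rw [dirichletMeasure_eq, dirichletMeasure_eq,
    restrict_withDensity (measurableSet_truncatedSimplex m c),
    ← withDensity_indicator (measurableSet_truncatedSimplex m c),
    ← withDensity_smul' _ _ ENNReal.ofReal_ne_top]
  refine withDensity_mono (ae_of_all _ fun x => Set.indicator_apply_le fun hx => ?_)
  have hMβ := inv_pos.2 (multiBeta_pos hβ)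
  have hMα := inv_pos.2 (multiBeta_pos hα)
  have hM := inv_multiBeta_le hα hβ hab hh ha hb hother hlo hloa hbhi hsum
  have hratio : 0 < betaFn lo hi / betaFn (lo + h) (hi - h) :=
    pos_of_mul_pos_left (hMα.trans_le hM) hMβ.le
  have hx1 : 0 < 1 - m * c :=
    (hc.trans_le (le_simplexCoord hx a)).trans_le (simplexCoord_le hx a)
  rw [Pi.smul_apply, smul_eq_mul, ← ENNReal.ofReal_mul (Real.exp_pos _).le, Real.exp_add,
    Real.exp_log hratio, mul_comm h, ← Real.rpow_def_of_pos (div_pos hx1 hc)]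
  refine ENNReal.ofReal_le_ofReal ?_
  calc (multiBeta α)⁻¹ * dirichletKernel α 1 x
      ≤ (betaFn lo hi / betaFn (lo + h) (hi - h) * (multiBeta β)⁻¹) *
          (((1 - m * c) / c) ^ h * dirichletKernel β 1 x) :=
        mul_le_mul hM (dirichletKernel_le hab hh ha hb hother hc hx)
          (dirichletKernel_nonneg _ _ _) (mul_pos hratio hMβ).le
    _ = _ := by ring

end DensityRatio

theorem stmt_15 (m : ℕ) (hn : 3 ≤ m + 1)
    (N : Fin (m+1) → ℕ) (hN : ∀ i, 0 < N i)
    (η γ k : Fin (m+1) → ℝ)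
    (hη : ∀ i, η i ∈ Set.Ioo (0:ℝ) (1/4))
    (hηN : ∀ i, η i + 1/(N i:ℝ) ≤ 1 - 2*η i)
    (hγ : ∀ i, γ i ∈ Set.Ioc (0:ℝ) (1/(m:ℝ)))
    (hk : ∀ i, 3/(2*η i) ≤ k i)
    (p q : Fin (m+1) → Fin (m+1) → ℝ)
    (hpr : ∀ i l, p i l ∈ Set.Icc (η i) (1 - 2*η i))
    (hqr : ∀ i l, q i l ∈ Set.Icc (η i) (1 - 2*η i))
    (hps : ∀ i, ∑ l, p i l = 1) (hqs : ∀ i, ∑ l, q i l = 1)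
    (j : Fin (m+1))
    (hrow : ∀ i, i ≠ j → p i = q i)
    (a b : Fin (m+1)) (hab : a ≠ b)
    (hpa : p j a = q j a + 1/(N j:ℝ)) (hpb : p j b = q j b - 1/(N j:ℝ))
    (hother : ∀ l, l ≠ a → l ≠ b → p j l = q j l)
    (δ : ℝ≥0∞)
    (hδ : 1 - dirichletMeasure (fun l => k j * p j l)
        {x : Fin m → ℝ | (∀ l, γ j ≤ x l) ∧ γ j ≤ 1 - ∑ l, x l} ≤ δ) :
    ∀ T : Set (Fin (m+1) → (Fin m → ℝ)), MeasurableSet T →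
      Measure.pi (fun i => dirichletMeasure (fun l => k i * p i l)) T ≤
        ENNReal.ofReal (Real.exp (
          Real.log (betaFn (k j * η j) (k j * (1-2*η j)) /
              betaFn (k j * (η j + 1/(N j:ℝ))) (k j * (1-2*η j - 1/(N j:ℝ)))) +
            (k j/(N j:ℝ)) * Real.log ((1-(m:ℝ)*γ j)/γ j))) *
          Measure.pi (fun i => dirichletMeasure (fun l => k i * q i l)) T + δ := by
  intro T hT
  have hk0 : ∀ i, 0 < k i := fun i =>
    (div_pos three_pos (mul_pos two_pos (hη i).1)).trans_le (hk i)
  have hα : ∀ i l, 0 < k i * p i l := fun i l =>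
    mul_pos (hk0 i) ((hη i).1.trans_le (hpr i l).1)
  have hβ : ∀ i l, 0 < k i * q i l := fun i l =>
    mul_pos (hk0 i) ((hη i).1.trans_le (hqr i l).1)
  have := fun i => isProbabilityMeasure_dirichletMeasure (hα i)
  have := fun i => isProbabilityMeasure_dirichletMeasure (hβ i)
  have hle := dirichletMeasure_restrict_le (h := k j / N j) (lo := k j * η j)
    (hi := k j * (1 - 2 * η j)) (hα j) (hβ j) hab
    (div_nonneg (hk0 j).le (Nat.cast_nonneg _)) (by rw [hpa]; ring) (by rw [hpb]; ring)
    (fun l h1 h2 => by rw [hother l h1 h2]) (mul_pos (hk0 j) (hη j).1)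
    (mul_le_mul_of_nonneg_left (hqr j a).1 (hk0 j).le)
    (mul_le_mul_of_nonneg_left (hqr j b).2 (hk0 j).le)
    (by rw [← Finset.mul_sum, ← Finset.mul_sum, hps, hqs]) (hγ j).1
  rw [show k j * η j + k j / N j = k j * (η j + 1 / (N j : ℝ)) by ring,
    show k j * (1 - 2 * η j) - k j / N j = k j * (1 - 2 * η j - 1 / (N j : ℝ)) by ring] at hle
  have hΩ := measurableSet_truncatedSimplex m (γ j)
  refine (pi_le_mul_pi_add (fun i => dirichletMeasure (fun l => k i * p i l))
    (fun i => dirichletMeasure (fun l => k i * q i l)) j (fun i hi => by rw [hrow i hi]) hΩ hle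
    hT).trans (add_le_add le_rfl ?_)
  rw [prob_compl_eq_one_sub hΩ]
  exact hδ
end
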